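/- arXiv:1504.04111 — 6 statements merged into one kernel-verified Lean document; each statement's English description precedes it below -/
import Mathlib

section
/- Let k ≥ 1, write m_k = u_1u_2⋯u_k ∈ R_k, and let χ be a generating character of R_k. Then for every x ∈ R_k with x ≠ 0 and x ≠ m_k, the sum of χ(α·x) over all units α of R_k equals 0. -/
open MvPolynomial

/-- The ring `R_k = F_2[u_1,…,u_k]/(u_i² = 0)`. -/
abbrev Rk (k : ℕ) : Type :=
  MvPolynomial (Fin k) (ZMod 2) ⧸
    Ideal.span (Set.range fun i : Fin k => (X i : MvPolynomial (Fin k) (ZMod 2)) ^ 2)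

/-- The element `m_k = u_1 u_2 ⋯ u_k ∈ R_k`. -/
noncomputable def uProd (k : ℕ) : Rk k :=
  Ideal.Quotient.mk _ (∏ i : Fin k, (X i : MvPolynomial (Fin k) (ZMod 2)))

/-- An additive character is generating if its kernel contains no nonzero ideal. -/
def IsGeneratingChar {k : ℕ} (χ : AddChar (Rk k) ℂ) : Prop :=
  ∀ I : Ideal (Rk k), I ≠ ⊥ → ∃ x ∈ I, χ x ≠ 1

/-- Translation of the unit group by a nilpotent element. -/
noncomputable def unitsAddNilpotent {R : Type*} [CommRing R] (n : R) (hn : IsNilpotent n) :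
    Rˣ ≃ Rˣ where
  toFun a := (hn.isUnit_add_left_of_commute a.isUnit (Commute.all _ _)).unit
  invFun a := (hn.neg.isUnit_add_left_of_commute a.isUnit (Commute.all _ _)).unit
  left_inv a := by ext; simp
  right_inv a := by ext; simp

/-- A nilpotent `n` with `χ (n * x) ≠ 1` makes the sum of `χ (α * x)` over the units vanish. -/
theorem finsum_units_addChar_eq_zero {R : Type*} [CommRing R] (χ : AddChar R ℂ) (x n : R)
    (hn : IsNilpotent n) (hχ : χ (n * x) ≠ 1) : ∑ᶠ α : Rˣ, χ ((α : R) * x) = 0 := by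
  have h : ∑ᶠ α : Rˣ, χ ((α : R) * x) = χ (n * x) * ∑ᶠ α : Rˣ, χ ((α : R) * x) := by
    rw [mul_finsum, ← finsum_comp_equiv (unitsAddNilpotent n hn)]
    refine finsum_congr fun α => ?_
    rw [← AddChar.map_add_eq_mul]
    congr 1
    simp only [unitsAddNilpotent, Equiv.coe_fn_mk, IsUnit.unit_spec]
    ring
  by_contra h0
  exact hχ (mul_right_cancel₀ h0 (by rw [← h, one_mul]))

/-- A polynomial lies in the ideal of squares of the variables iff each of its monomials is
divisible by such a square. -/
theorem mem_span_range_X_sq {σ R : Type*} [CommSemiring R] (p : MvPolynomial σ R) :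
    p ∈ Ideal.span (Set.range fun i : σ => (X i : MvPolynomial σ R) ^ 2) ↔
      ∀ m ∈ p.support, ∃ i, 2 ≤ m i := by
  have h : (Set.range fun i : σ => (X i : MvPolynomial σ R) ^ 2) =
      (fun s => monomial s (1 : R)) '' Set.range fun i : σ => Finsupp.single i 2 := by
    rw [← Set.range_comp]
    simp [Function.comp_def, X_pow_eq_monomial]
  rw [h, mem_ideal_span_monomial_image]
  simp [Finsupp.single_le_iff]

/-- The socle of `R_k` is `{0, m_k}`. -/
theorem eq_zero_or_eq_uProd {k : ℕ} (x : Rk k)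
    (hx : ∀ i : Fin k, Ideal.Quotient.mk _ (X i) * x = 0) : x = 0 ∨ x = uProd k := by
  obtain ⟨p, rfl⟩ := Ideal.Quotient.mk_surjective x
  let e : Fin k →₀ ℕ := Finsupp.equivFunOnFinite.symm fun _ => 1
  have he : ∏ i : Fin k, (X i : MvPolynomial (Fin k) (ZMod 2)) = monomial e 1 := by
    rw [monomial_eq, Finsupp.prod_fintype _ _ (by simp)]
    simp [e]
  have hsupp : ∀ m ∈ p.support, m ≠ e → ∃ i, 2 ≤ m i := by
    intro m hm hne
    by_contra! hlt
    refine hne (Finsupp.ext fun i => ?_)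
    have hi := hx i
    rw [← map_mul, Ideal.Quotient.eq_zero_iff_mem, mem_span_range_X_sq] at hi
    obtain ⟨j, hj⟩ := hi (Finsupp.single i 1 + m) (by
      rw [mem_support_iff, coeff_X_mul]; exact mem_support_iff.mp hm)
    have hmi := hlt i
    have hmj := hlt j
    rw [Finsupp.add_apply, Finsupp.single_apply] at hj
    change m i = 1
    split_ifs at hj with hij
    · subst hij; omega
    · omega
  have key : ∀ c, coeff e p = c →
      Ideal.Quotient.mk (Ideal.span (Set.range fun i : Fin k =>
        (X i : MvPolynomial (Fin k) (ZMod 2)) ^ 2)) p = Ideal.Quotient.mk _ (monomial e c) := by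
    intro c hc
    rw [Ideal.Quotient.eq, mem_span_range_X_sq]
    intro m hm
    rw [mem_support_iff, coeff_sub, coeff_monomial] at hm
    by_cases hme : e = m
    · subst hme; simp [hc] at hm
    · exact hsupp m (by simpa [hme] using hm) (Ne.symm hme)
  have h2 : ∀ c : ZMod 2, c = 0 ∨ c = 1 := by decide
  rcases h2 (coeff e p) with hc | hc
  · left; simpa using key 0 hc
  · right; rw [uProd, he]; exact key 1 hc

theorem sum_char_units_eq_zero (k : ℕ) (hk : 1 ≤ k)
    (χ : AddChar (Rk k) ℂ) (hχ : IsGeneratingChar χ)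
    (x : Rk k) (hx0 : x ≠ 0) (hxm : x ≠ uProd k) :
    ∑ᶠ α : (Rk k)ˣ, χ ((α : Rk k) * x) = 0 := by
  obtain ⟨i, hi⟩ : ∃ i : Fin k, Ideal.Quotient.mk _ (X i) * x ≠ 0 := by
    by_contra! h
    exact (eq_zero_or_eq_uProd x h).elim hx0 hxm
  obtain ⟨y, hy, hy1⟩ := hχ (Ideal.span {Ideal.Quotient.mk _ (X i) * x})
    (by rwa [Ne, Ideal.span_singleton_eq_bot])
  obtain ⟨a, rfl⟩ := Ideal.mem_span_singleton'.mp hy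
  rw [← mul_assoc] at hy1
  refine finsum_units_addChar_eq_zero χ x _ ((Commute.all _ _).isNilpotent_mul_left ⟨2, ?_⟩) hy1
  rw [← map_pow, Ideal.Quotient.eq_zero_iff_mem]
  exact Ideal.subset_span ⟨i, rfl⟩
end

section
/- Let k ≥ 1, write m_k = u_1u_2⋯u_k ∈ R_k, and let χ be a generating character of R_k. Then for every x ∈ R_k, the sum of χ(x·α) over all units α of R_k equals 2^(2^k − 1) if x = 0, equals −2^(2^k − 1) if x = m_k, and equals 0 otherwise. Consequently the homogeneous weight of R_k determined by χ via Honold's formula w(x) = γ·(1 − |R_k^×|^{-1}·Σ_{α unit} χ(xα)) takes the value 0 at x = 0, the value 2γ at x = m_k, and the value γ at every other element. -/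
open MvPolynomial

namespace Rk

variable {k : ℕ}

/-- The exponent vector of the squarefree monomial with the given exponents in `{0, 1}`. -/
noncomputable def exponent (s : Fin k → Fin 2) : Fin k →₀ ℕ :=
  Finsupp.equivFunOnFinite.symm fun i => (s i : ℕ)

@[simp]
lemma exponent_apply (s : Fin k → Fin 2) (i : Fin k) : exponent s i = (s i : ℕ) := rfl

lemma exponent_injective : Function.Injective (exponent (k := k)) := fun s t h =>
  funext fun i => Fin.ext (by simpa using DFunLike.congr_fun h i)

lemma exists_exponent_eq {m : Fin k →₀ ℕ} (h : ∀ i, m i < 2) : ∃ s, exponent s = m :=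
  ⟨fun i => ⟨m i, h i⟩, by ext i; simp⟩

/-- The coefficients of the squarefree monomials of a polynomial. -/
noncomputable def squarefreeCoeff (k : ℕ) :
    MvPolynomial (Fin k) (ZMod 2) →+ ((Fin k → Fin 2) → ZMod 2) where
  toFun p s := coeff (exponent s) p
  map_zero' := by ext; simp
  map_add' p q := by ext; simp

lemma squarefreeCoeff_apply (p : MvPolynomial (Fin k) (ZMod 2)) (s : Fin k → Fin 2) :
    squarefreeCoeff k p s = coeff (exponent s) p := rfl

lemma mk_eq_zero_iff {p : MvPolynomial (Fin k) (ZMod 2)} :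
    (Ideal.Quotient.mk _ p : Rk k) = 0 ↔ squarefreeCoeff k p = 0 := by
  have hspan : (Set.range fun i : Fin k => (X i : MvPolynomial (Fin k) (ZMod 2)) ^ 2) =
      (fun m => monomial m (1 : ZMod 2)) '' Set.range fun i : Fin k => Finsupp.single i 2 := by
    rw [← Set.range_comp]
    simp [Function.comp_def, X_pow_eq_monomial]
  rw [Ideal.Quotient.eq_zero_iff_mem, hspan, mem_ideal_span_monomial_image]
  simp only [Set.exists_range_iff, Finsupp.single_le_iff, mem_support_iff]
  constructor
  · intro h
    ext s
    by_contra hs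
    obtain ⟨i, hi⟩ := h _ hs
    simp only [exponent_apply] at hi
    omega
  · intro h m hm
    by_contra! hlt
    obtain ⟨s, rfl⟩ := exists_exponent_eq hlt
    exact hm (congr_fun h s)

lemma squarefreeCoeff_surjective : Function.Surjective (squarefreeCoeff k) := by
  intro c
  refine ⟨∑ s, monomial (exponent s) (c s), ?_⟩
  ext t
  simp [squarefreeCoeff_apply, coeff_sum, coeff_monomial, exponent_injective.eq_iff]

/-- As an additive group, `R_k` is free over `ZMod 2` on the squarefree monomials. -/
noncomputable def addEquivSquarefreeCoeff (k : ℕ) : Rk k ≃+ ((Fin k → Fin 2) → ZMod 2) :=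
  AddEquiv.ofBijective
    (QuotientAddGroup.lift _ (squarefreeCoeff k) fun _ hp =>
      mk_eq_zero_iff.1 (Ideal.Quotient.eq_zero_iff_mem.2 hp)) <| by
    refine ⟨(injective_iff_map_eq_zero _).2 fun x => ?_, fun c => ?_⟩
    · obtain ⟨p, rfl⟩ := Ideal.Quotient.mk_surjective x
      exact mk_eq_zero_iff.2
    · obtain ⟨p, rfl⟩ := squarefreeCoeff_surjective c
      exact ⟨Ideal.Quotient.mk _ p, rfl⟩

instance : Finite (Rk k) := Finite.of_equiv _ (addEquivSquarefreeCoeff k).symm.toEquiv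

lemma card_eq (k : ℕ) : Nat.card (Rk k) = 2 ^ 2 ^ k := by
  rw [Nat.card_congr (addEquivSquarefreeCoeff k).toEquiv]
  simp

lemma mk_X_sq (i : Fin k) : (Ideal.Quotient.mk _ (X i) : Rk k) ^ 2 = 0 := by
  rw [← map_pow, Ideal.Quotient.eq_zero_iff_mem]
  exact Ideal.subset_span ⟨i, rfl⟩

/-- The augmentation `R_k → F_2` sending every `u_i` to zero. -/
noncomputable def augmentation (k : ℕ) : Rk k →+* ZMod 2 :=
  Ideal.Quotient.lift _ constantCoeff fun p hp => by
    refine (Ideal.span_le (I := RingHom.ker constantCoeff)).2 ?_ hp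
    rintro _ ⟨i, rfl⟩
    simp [RingHom.mem_ker]

@[simp]
lemma augmentation_mk (p : MvPolynomial (Fin k) (ZMod 2)) :
    augmentation k (Ideal.Quotient.mk _ p) = constantCoeff p := rfl

lemma sq_eq_algebraMap_augmentation (x : Rk k) :
    x ^ 2 = algebraMap (ZMod 2) (Rk k) (augmentation k x) := by
  obtain ⟨p, rfl⟩ := Ideal.Quotient.mk_surjective x
  have : CharP (Rk k) 2 := by
    have : Nontrivial (Rk k) := (augmentation k).domain_nontrivial
    exact charP_of_injective_algebraMap (algebraMap (ZMod 2) (Rk k)).injective 2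
  induction p using MvPolynomial.induction_on with
  | C a =>
    rw [augmentation_mk, constantCoeff_C, ← map_pow, ← C_pow, ZMod.pow_card a]
    rfl
  | add p q hp hq => rw [map_add, add_pow_char, hp, hq, map_add, map_add]
  | mul_X p i hp => rw [map_mul, mul_pow, mk_X_sq]; simp

lemma isUnit_iff {x : Rk k} : IsUnit x ↔ x ∉ RingHom.ker (augmentation k) := by
  rw [RingHom.mem_ker]
  refine ⟨fun h => (h.map (augmentation k)).ne_zero, fun h => ?_⟩
  have h1 : augmentation k x = 1 := Fin.eq_one_of_ne_zero _ h
  refine IsUnit.of_mul_eq_one x ?_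
  rw [← sq, sq_eq_algebraMap_augmentation, h1, map_one]

lemma card_ker_augmentation (k : ℕ) :
    Nat.card (RingHom.ker (augmentation k)) = 2 ^ (2 ^ k - 1) := by
  have hsurj : Function.Surjective (augmentation k) := fun a =>
    ⟨Ideal.Quotient.mk _ (C a), by simp⟩
  have h := Submodule.card_eq_card_quotient_mul_card (RingHom.ker (augmentation k))
  rw [card_eq, Nat.card_congr
    (RingHom.quotientKerEquivOfSurjective hsurj).toEquiv, Nat.card_zmod] at h
  have h2 : 2 ^ 2 ^ k = 2 * 2 ^ (2 ^ k - 1) := by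
    rw [← pow_succ', Nat.sub_add_cancel Nat.one_le_two_pow]
  omega

lemma prod_X_eq_monomial :
    (∏ i : Fin k, (X i : MvPolynomial (Fin k) (ZMod 2))) =
      monomial (exponent fun _ => 1) 1 := by
  rw [monomial_eq, C_1, one_mul, Finsupp.prod_fintype _ _ fun _ => pow_zero _]
  simp

lemma uProd_ne_zero : uProd k ≠ 0 := by
  rw [uProd, Ne, mk_eq_zero_iff, prod_X_eq_monomial]
  intro h
  simpa [squarefreeCoeff_apply] using congr_fun h fun _ => 1

lemma uProd_mul_eq_zero {x : Rk k} (hx : x ∈ RingHom.ker (augmentation k)) :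
    uProd k * x = 0 := by
  suffices h : ∀ y : Rk k, uProd k * y = uProd k * algebraMap (ZMod 2) _ (augmentation k y) by
    rw [h, RingHom.mem_ker.1 hx, map_zero, mul_zero]
  intro y
  obtain ⟨p, rfl⟩ := Ideal.Quotient.mk_surjective y
  induction p using MvPolynomial.induction_on with
  | C a => rw [augmentation_mk, constantCoeff_C]; rfl
  | add p q hp hq => rw [map_add, mul_add, hp, hq, map_add, map_add, mul_add]
  | mul_X p i hp =>
    have h : uProd k * Ideal.Quotient.mk _ (X i) = 0 := by
      rw [uProd, ← Finset.mul_prod_erase _ _ (Finset.mem_univ i), map_mul, mul_right_comm, ← sq,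
        mk_X_sq, zero_mul]
    rw [map_mul, mul_left_comm, h]
    simp

lemma eq_zero_or_eq_uProd {x : Rk k}
    (hx : ∀ y ∈ RingHom.ker (augmentation k), x * y = 0) : x = 0 ∨ x = uProd k := by
  obtain ⟨p, rfl⟩ := Ideal.Quotient.mk_surjective x
  have hp : ∀ s : Fin k → Fin 2, s ≠ (fun _ => 1) → coeff (exponent s) p = 0 := by
    intro s hs
    obtain ⟨i, hi⟩ := Function.ne_iff.1 hs
    have h := hx (Ideal.Quotient.mk _ (X i)) (by simp [RingHom.mem_ker])
    rw [← map_mul, mk_eq_zero_iff] at h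
    have he : exponent (Function.update s i 1) = exponent s + Finsupp.single i 1 := by
      ext j
      rcases eq_or_ne j i with rfl | hj
      · have : s j = 0 := by omega
        simp [this]
      · simp [hj]
    simpa [squarefreeCoeff_apply, he] using congr_fun h (Function.update s i 1)
  have heq : (Ideal.Quotient.mk _ p : Rk k) =
      Ideal.Quotient.mk _ (monomial (exponent fun _ => 1) (coeff (exponent fun _ => 1) p)) := by
    rw [← sub_eq_zero, ← map_sub, mk_eq_zero_iff]
    ext s
    by_cases hs : s = fun _ => 1
    · simp [squarefreeCoeff_apply, hs]
    · simp [squarefreeCoeff_apply, hp s hs, coeff_monomial, exponent_injective.eq_iff, Ne.symm hs]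
  by_cases h0 : coeff (exponent fun _ => 1) p = 0
  · left
    rw [heq, h0, map_zero, map_zero]
  · right
    have h1 : coeff (exponent fun _ => 1) p = 1 := Fin.eq_one_of_ne_zero _ h0
    rw [heq, h1, uProd, prod_X_eq_monomial]

open Classical in
lemma sum_char_mul_ideal [Fintype (Rk k)] {χ : AddChar (Rk k) ℂ} (hχ : IsGeneratingChar χ)
    (J : Ideal (Rk k)) (x : Rk k) :
    ∑ r : J, χ (x * r) = if ∀ r ∈ J, x * r = 0 then (Nat.card J : ℂ) else 0 := by
  split_ifs with h
  · simp [h]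
  · let ψ : AddChar J ℂ := χ.compAddMonoidHom
      ((AddMonoidHom.mulLeft x).comp J.subtype.toAddMonoidHom)
    have hψ : ψ ≠ 1 := by
      push Not at h
      obtain ⟨r, hr, hxr⟩ := h
      obtain ⟨_, ⟨t, ht, rfl⟩, hne⟩ := hχ (Submodule.map (LinearMap.mulLeft (Rk k) x) J) fun hb =>
        hxr <| by
          rw [← Submodule.mem_bot (Rk k), ← hb]
          exact ⟨r, hr, rfl⟩
      exact fun h1 => hne (DFunLike.congr_fun h1 (⟨t, ht⟩ : J))
    exact AddChar.sum_eq_zero_of_ne_one hψ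

lemma finsum_units_eq [Fintype (Rk k)] [Fintype (RingHom.ker (augmentation k))]
    (f : Rk k → ℂ) :
    ∑ᶠ α : (Rk k)ˣ, f α = ∑ r, f r - ∑ r : RingHom.ker (augmentation k), f r := by
  classical
  have : Fintype (Rk k)ˣ := Fintype.ofFinite _
  rw [finsum_eq_sum_of_fintype, eq_sub_iff_add_eq']
  rw [← Finset.sum_filter_add_sum_filter_not Finset.univ (· ∈ RingHom.ker (augmentation k))]
  congr 1
  · exact (Finset.sum_subtype _ (by simp) f).symm
  · refine (Finset.sum_map Finset.univ ⟨Units.val, Units.val_injective⟩ f).symm.trans ?_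
    refine Finset.sum_congr ?_ fun _ _ => rfl
    ext x
    simp only [Finset.mem_map, Finset.mem_filter_univ, ← isUnit_iff]
    simp [IsUnit]

open Classical in
lemma finsum_units_char {χ : AddChar (Rk k) ℂ} (hχ : IsGeneratingChar χ) (x : Rk k) :
    ∑ᶠ α : (Rk k)ˣ, χ (x * α) =
      (if x = 0 then (2 : ℂ) ^ 2 ^ k else 0) -
        if x = 0 ∨ x = uProd k then (2 : ℂ) ^ (2 ^ k - 1) else 0 := by
  have : Fintype (Rk k) := Fintype.ofFinite _
  rw [finsum_units_eq fun r => χ (x * r), sum_char_mul_ideal hχ, card_ker_augmentation]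
  have htop : ∑ r, χ (x * r) = ∑ r : (⊤ : Ideal (Rk k)), χ (x * r) :=
    Finset.sum_subtype _ (by simp) fun r => χ (x * r)
  rw [htop, sum_char_mul_ideal hχ]
  have h1 : (∀ r ∈ (⊤ : Ideal (Rk k)), x * r = 0) ↔ x = 0 :=
    ⟨fun h => by simpa using h 1 trivial, by rintro rfl; simp⟩
  have h2 : (∀ r ∈ RingHom.ker (augmentation k), x * r = 0) ↔ x = 0 ∨ x = uProd k := by
    refine ⟨eq_zero_or_eq_uProd, ?_⟩
    rintro (rfl | rfl) r hr
    · exact zero_mul r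
    · exact uProd_mul_eq_zero hr
  have h3 : Nat.card (⊤ : Ideal (Rk k)) = 2 ^ 2 ^ k := by
    rw [← card_eq]
    exact Nat.card_congr (Equiv.Set.univ (Rk k))
  simp only [h1, h2, h3]
  push_cast
  rfl

lemma two_pow_sub_two_pow (k : ℕ) :
    (2 : ℂ) ^ 2 ^ k - 2 ^ (2 ^ k - 1) = 2 ^ (2 ^ k - 1) := by
  obtain ⟨n, hn⟩ := Nat.exists_eq_add_of_le' (Nat.one_le_two_pow (n := k))
  rw [hn, Nat.add_sub_cancel]
  ring

lemma card_units (k : ℕ) : (Nat.card (Rk k)ˣ : ℂ) = 2 ^ (2 ^ k - 1) := by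
  have : Fintype (Rk k) := Fintype.ofFinite _
  have : Fintype (RingHom.ker (augmentation k)) := Fintype.ofFinite _
  have : Fintype (Rk k)ˣ := Fintype.ofFinite _
  have h := finsum_units_eq fun _ : Rk k => (1 : ℂ)
  rw [finsum_eq_sum_of_fintype] at h
  simp only [Finset.sum_const, Finset.card_univ, ← Nat.card_eq_fintype_card, card_eq,
    card_ker_augmentation, nsmul_eq_mul, mul_one] at h
  rw [h]
  push_cast
  exact two_pow_sub_two_pow k

end Rk

theorem sum_char_units_and_homogeneous_weight (k : ℕ) (hk : 1 ≤ k)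
    (χ : AddChar (Rk k) ℂ) (hχ : IsGeneratingChar χ) (γ : ℝ) :
    (∑ᶠ α : (Rk k)ˣ, χ ((0 : Rk k) * (α : Rk k)) = (2 : ℂ) ^ (2 ^ k - 1)) ∧
    (∑ᶠ α : (Rk k)ˣ, χ (uProd k * (α : Rk k)) = -((2 : ℂ) ^ (2 ^ k - 1))) ∧
    (∀ x : Rk k, x ≠ 0 → x ≠ uProd k → ∑ᶠ α : (Rk k)ˣ, χ (x * (α : Rk k)) = 0) ∧
    (∀ w : Rk k → ℂ,
      (∀ x : Rk k, w x =
        (γ : ℂ) * (1 - (Nat.card (Rk k)ˣ : ℂ)⁻¹ * ∑ᶠ α : (Rk k)ˣ, χ (x * (α : Rk k)))) →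
      w 0 = 0 ∧ w (uProd k) = 2 * (γ : ℂ) ∧
        ∀ x : Rk k, x ≠ 0 → x ≠ uProd k → w x = (γ : ℂ)) := by
  have h0 : ∑ᶠ α : (Rk k)ˣ, χ ((0 : Rk k) * (α : Rk k)) = (2 : ℂ) ^ (2 ^ k - 1) := by
    rw [Rk.finsum_units_char hχ, if_pos rfl, if_pos (Or.inl rfl), Rk.two_pow_sub_two_pow]
  have hm : ∑ᶠ α : (Rk k)ˣ, χ (uProd k * (α : Rk k)) = -((2 : ℂ) ^ (2 ^ k - 1)) := by
    rw [Rk.finsum_units_char hχ, if_neg Rk.uProd_ne_zero, if_pos (Or.inr rfl), zero_sub]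
  have hne : ∀ x : Rk k, x ≠ 0 → x ≠ uProd k → ∑ᶠ α : (Rk k)ˣ, χ (x * (α : Rk k)) = 0 := by
    intro x hx hx'
    rw [Rk.finsum_units_char hχ, if_neg hx, if_neg (not_or.2 ⟨hx, hx'⟩), sub_zero]
  have hpow : (2 : ℂ) ^ (2 ^ k - 1) ≠ 0 := pow_ne_zero _ two_ne_zero
  refine ⟨h0, hm, hne, fun w hw => ⟨?_, ?_, fun x hx hx' => ?_⟩⟩
  · rw [hw, h0, Rk.card_units, inv_mul_cancel₀ hpow, sub_self, mul_zero]
  · rw [hw, hm, Rk.card_units, mul_neg, inv_mul_cancel₀ hpow]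
    ring
  · rw [hw, hne x hx hx', mul_zero, sub_zero, mul_one]
end

section
/- Let k ≥ 1. There exists an injective F_2-linear map ψ : R_k → ((ZMod 2)^(2^(2^k − 1))) (R_k regarded as a vector space over its prime field F_2 = ZMod 2) such that for every x ∈ R_k the Hamming weight of ψ(x) equals w_hom(x). Consequently ψ is a distance-preserving isometry from R_k with the homogeneous distance to (ZMod 2)^(2^(2^k − 1)) with the Hamming distance: the Hamming distance between ψ(x) and ψ(y) equals w_hom(x − y) for all x, y ∈ R_k. -/
open MvPolynomial

open Classical in
/-- The homogeneous weight on `R_k` with `γ = 2^(2^k - 2)`. -/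
noncomputable def whom (k : ℕ) (x : Rk k) : ℕ :=
  if x = 0 then 0 else if x = uProd k then 2 ^ (2 ^ k - 1) else 2 ^ (2 ^ k - 2)

open Module

/-- Over a field with two elements, there are `2 ^ (dim V - #ι)` linear functionals taking
prescribed values on a linearly independent family indexed by `ι`. -/
theorem card_dual_prescribed {V ι : Type*} [AddCommGroup V] [Module (ZMod 2) V]
    [Module.Finite (ZMod 2) V] [Fintype ι] {v : ι → V} (hv : LinearIndependent (ZMod 2) v)
    (w : ι → ZMod 2) :
    Nat.card {φ : Dual (ZMod 2) V // ∀ i, φ (v i) = w i} =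
      2 ^ (finrank (ZMod 2) V - Fintype.card ι) := by
  let e : Dual (ZMod 2) V →ₗ[ZMod 2] (ι → ZMod 2) :=
    LinearMap.pi fun i => Dual.eval (ZMod 2) V (v i)
  have e_apply (φ : Dual (ZMod 2) V) (i : ι) : e φ i = φ (v i) := rfl
  have he : Function.Surjective e := by
    intro w
    obtain ⟨g, hg⟩ := LinearMap.exists_leftInverse_of_injective
      (Fintype.linearCombination (ZMod 2) v)
      (LinearMap.ker_eq_bot.2 hv.fintypeLinearCombination_injective)
    refine ⟨Fintype.linearCombination (ZMod 2) w ∘ₗ g, ?_⟩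
    classical
    ext i
    have h := LinearMap.congr_fun hg (Pi.single i 1)
    simp only [LinearMap.comp_apply, Fintype.linearCombination_apply_single, one_smul,
      LinearMap.id_apply] at h
    simp [e_apply, h, Fintype.linearCombination_apply_single]
  obtain ⟨φ₀, hφ₀⟩ := he w
  have hfiber : {φ : Dual (ZMod 2) V // ∀ i, φ (v i) = w i} ≃ LinearMap.ker e :=
    (Equiv.subRight φ₀).subtypeEquiv fun φ => by
      simp [LinearMap.mem_ker, sub_eq_zero, hφ₀, _root_.funext_iff, e_apply]
  have hrank := e.finrank_range_add_finrank_ker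
  rw [LinearMap.range_eq_top.2 he, finrank_top, finrank_pi, Subspace.dual_finrank_eq] at hrank
  rw [Nat.card_congr hfiber, Module.natCard_eq_pow_finrank (K := ZMod 2), Nat.card_zmod, ← hrank,
    Nat.add_sub_cancel_left]

/-- Evaluating all functionals that do not vanish at `m` is a two-weight linear map. -/
theorem exists_linearMap_hammingNorm_eq {V : Type*} [AddCommGroup V] [Module (ZMod 2) V]
    [Module.Finite (ZMod 2) V] {m : V} (hm : m ≠ 0) :
    ∃ ψ : V →ₗ[ZMod 2] (Fin (2 ^ (finrank (ZMod 2) V - 1)) → ZMod 2),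
      hammingNorm (ψ m) = 2 ^ (finrank (ZMod 2) V - 1) ∧
      ∀ x, x ≠ 0 → x ≠ m → hammingNorm (ψ x) = 2 ^ (finrank (ZMod 2) V - 2) := by
  have : Finite (Dual (ZMod 2) V) := Module.finite_of_finite (ZMod 2)
  have ne_zero (a : ZMod 2) : a ≠ 0 ↔ a = 1 := by revert a; decide
  have hcard : Nat.card {φ : Dual (ZMod 2) V // φ m = 1} = 2 ^ (finrank (ZMod 2) V - 1) := by
    simpa using card_dual_prescribed (LinearIndependent.of_subsingleton (v := ![m]) 0 hm) ![1]
  let e := Finite.equivFinOfCardEq hcard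
  let ψ : V →ₗ[ZMod 2] (Fin (2 ^ (finrank (ZMod 2) V - 1)) → ZMod 2) :=
    LinearMap.pi fun i => (e.symm i).1
  have norm_eq (x : V) :
      hammingNorm (ψ x) = Nat.card {φ : Dual (ZMod 2) V // φ m = 1 ∧ φ x = 1} := by
    rw [hammingNorm, ← Fintype.card_subtype, ← Nat.card_eq_fintype_card]
    refine Nat.card_congr ((e.symm.subtypeEquiv fun i => ?_).trans
      (Equiv.subtypeSubtypeEquivSubtypeInter (fun φ : Dual (ZMod 2) V => φ m = 1)
        fun φ => φ x = 1))
    exact ne_zero _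
  refine ⟨ψ, by simpa [norm_eq] using hcard, fun x hx hxm => ?_⟩
  have hind : LinearIndependent (ZMod 2) ![m, x] := by
    rw [LinearIndependent.pair_iff]
    intro s t h
    have cases (a : ZMod 2) : a = 0 ∨ a = 1 := by revert a; decide
    rcases cases s with rfl | rfl <;> rcases cases t with rfl | rfl
    · simp
    · simp [hx] at h
    · simp [hm] at h
    · refine absurd ?_ hxm
      rw [one_smul, one_smul] at h
      have hxx : x + x = 0 := by
        rw [← two_smul (ZMod 2) x, show (2 : ZMod 2) = 0 from rfl, zero_smul]
      exact add_right_cancel (hxx.trans h.symm)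
  simpa [norm_eq, Fin.forall_fin_two] using card_dual_prescribed hind ![1, 1]

/-- The coefficients of the squarefree monomials of a polynomial. -/
noncomputable def squarefreeCoeff (k : ℕ) :
    MvPolynomial (Fin k) (ZMod 2) →ₗ[ZMod 2] (Finset (Fin k) → ZMod 2) :=
  LinearMap.pi fun s => lcoeff (ZMod 2) (Finsupp.indicator s fun _ _ => 1)

theorem squarefreeCoeff_apply (k : ℕ) (p : MvPolynomial (Fin k) (ZMod 2)) (s : Finset (Fin k)) :
    squarefreeCoeff k p s = coeff (Finsupp.indicator s fun _ _ => 1) p := rfl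

theorem squarefreeCoeff_surjective (k : ℕ) : Function.Surjective (squarefreeCoeff k) := by
  intro f
  refine ⟨∑ s, monomial (Finsupp.indicator s fun _ _ => 1) (f s), ?_⟩
  ext t
  have inj (s : Finset (Fin k)) :
      ((Finsupp.indicator s fun _ _ => 1 : Fin k →₀ ℕ) = Finsupp.indicator t fun _ _ => 1) ↔
        s = t := by
    refine ⟨fun h => ?_, fun h => h ▸ rfl⟩
    ext i
    have := DFunLike.congr_fun h i
    simp only [Finsupp.indicator_apply] at this
    split_ifs at this <;> simp_all
  simp [squarefreeCoeff_apply, coeff_sum, coeff_monomial, inj]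

theorem squarefreeCoeff_eq_zero_iff (k : ℕ) (p : MvPolynomial (Fin k) (ZMod 2)) :
    squarefreeCoeff k p = 0 ↔
      p ∈ Ideal.span (Set.range fun i : Fin k => (X i : MvPolynomial (Fin k) (ZMod 2)) ^ 2) := by
  have hgen : (Set.range fun i : Fin k => (X i : MvPolynomial (Fin k) (ZMod 2)) ^ 2) =
      (fun s => monomial s (1 : ZMod 2)) '' Set.range fun i : Fin k => Finsupp.single i 2 := by
    rw [← Set.range_comp]
    simp only [Function.comp_def, X_pow_eq_monomial]
  rw [hgen, mem_ideal_span_monomial_image]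
  simp only [Set.exists_range_iff, Finsupp.single_le_iff, MvPolynomial.mem_support_iff]
  constructor
  · intro h d hd
    by_contra! hlt
    refine hd ?_
    have hd_eq : d = Finsupp.indicator d.support fun _ _ => 1 := by
      ext i
      have := hlt i
      simp only [Finsupp.indicator_apply, Finsupp.mem_support_iff]
      split_ifs <;> omega
    rw [hd_eq]
    exact congr_fun h d.support
  · intro h
    ext s
    by_contra hs
    obtain ⟨i, hi⟩ := h _ hs
    rw [Finsupp.indicator_apply] at hi
    split_ifs at hi <;> omega

/-- The coordinates of `R_k` in the basis of squarefree monomials. -/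
noncomputable def rkEquivFun (k : ℕ) : Rk k ≃ₗ[ZMod 2] (Finset (Fin k) → ZMod 2) :=
  (LinearMap.quotKerEquivOfSurjective (Ideal.Quotient.mkₐ (ZMod 2) (Ideal.span
      (Set.range fun i : Fin k => (X i : MvPolynomial (Fin k) (ZMod 2)) ^ 2))).toLinearMap
      (Ideal.Quotient.mkₐ_surjective (ZMod 2) _)).symm ≪≫ₗ
    Submodule.quotEquivOfEq _ _ (by
      ext p
      rw [LinearMap.mem_ker, LinearMap.mem_ker, squarefreeCoeff_eq_zero_iff]
      exact Ideal.Quotient.eq_zero_iff_mem) ≪≫ₗ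
    LinearMap.quotKerEquivOfSurjective (squarefreeCoeff k) (squarefreeCoeff_surjective k)

instance (k : ℕ) : Module.Finite (ZMod 2) (Rk k) := Module.Finite.equiv (rkEquivFun k).symm

theorem finrank_Rk (k : ℕ) : finrank (ZMod 2) (Rk k) = 2 ^ k := by
  rw [(rkEquivFun k).finrank_eq, finrank_pi, Fintype.card_finset, Fintype.card_fin]

theorem uProd_ne_zero (k : ℕ) : uProd k ≠ 0 := by
  rw [uProd, Ne, Ideal.Quotient.eq_zero_iff_mem, ← squarefreeCoeff_eq_zero_iff]
  intro h
  have hprod : (∏ i : Fin k, (X i : MvPolynomial (Fin k) (ZMod 2))) =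
      monomial (Finsupp.indicator Finset.univ fun _ _ => 1) 1 := by
    rw [monomial_eq, Finsupp.prod_fintype _ _ (by simp)]
    simp
  have := congr_fun h Finset.univ
  rw [hprod, squarefreeCoeff_apply, coeff_monomial, if_pos rfl] at this
  exact one_ne_zero this

theorem exists_homogeneous_gray_map (k : ℕ) (hk : 1 ≤ k) :
    ∃ ψ : Rk k →ₗ[ZMod 2] (Fin (2 ^ (2 ^ k - 1)) → ZMod 2),
      Function.Injective ψ ∧
      (∀ x : Rk k, hammingNorm (ψ x) = whom k x) ∧
      (∀ x y : Rk k, hammingDist (ψ x) (ψ y) = whom k (x - y)) := by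
  have h := exists_linearMap_hammingNorm_eq (uProd_ne_zero k)
  rw [finrank_Rk] at h
  obtain ⟨ψ, hψm, hψ⟩ := h
  have hnorm (x : Rk k) : hammingNorm (ψ x) = whom k x := by
    unfold whom
    split_ifs with h0 hm
    · simp [h0]
    · rw [hm, hψm]
    · exact hψ x h0 hm
  refine ⟨ψ, (injective_iff_map_eq_zero ψ).2 fun x hx => ?_, hnorm, fun x y => ?_⟩
  · by_contra h0
    have hx' := hnorm x
    rw [hx, hammingNorm_zero, whom, if_neg h0] at hx'
    split_ifs at hx' <;> exact absurd hx'.symm (by positivity)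
  · rw [hammingDist_comm, hammingDist_eq_hammingNorm, neg_add_eq_sub, ← map_sub, hnorm]
end

section
/- Let k ≥ 1, let λ be a unit of R_k, let n be an odd positive integer, and let C be an R_k-submodule of R_k^n. Define the monomial map ν : R_k^n → R_k^n by ν(a)_i = λ^i · a_i for 0 ≤ i ≤ n−1. Then C is λ-constacyclic (T_λ(C) = C) if and only if ν(C) is cyclic (T(ν(C)) = ν(C)). In particular, up to the monomial equivalence ν, λ-constacyclic codes of odd length over R_k are exactly the cyclic codes of that length. -/
open MvPolynomial

/-- The `λ`-shift `T_λ(a_0,…,a_{n−1}) = (λa_{n−1}, a_0, …, a_{n−2})`;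
`lamShift 1` is the cyclic shift `T`. -/
def lamShift {R : Type*} [CommRing R] {n : ℕ} [NeZero n] (lam : R)
    (a : Fin n → R) : Fin n → R :=
  fun i => if i = 0 then lam * a (i - 1) else a (i - 1)

/-- Squares in `R_k` are constants. -/
lemma Rk.exists_mk_sq_eq_mk_C (k : ℕ) (p : MvPolynomial (Fin k) (ZMod 2)) :
    ∃ c : ZMod 2, (Ideal.Quotient.mk (Ideal.span (Set.range fun i : Fin k =>
      (X i : MvPolynomial (Fin k) (ZMod 2)) ^ 2)) (p ^ 2) : Rk k) =
      Ideal.Quotient.mk _ (MvPolynomial.C c) := by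
  induction p using MvPolynomial.induction_on with
  | C a => exact ⟨a ^ 2, by rw [MvPolynomial.C_pow]⟩
  | add p q hp hq =>
    obtain ⟨c, hc⟩ := hp
    obtain ⟨d, hd⟩ := hq
    exact ⟨c + d, by rw [CharTwo.add_sq, RingHom.map_add, hc, hd, MvPolynomial.C_add,
      RingHom.map_add]⟩
  | mul_X p i _ =>
    refine ⟨0, ?_⟩
    rw [MvPolynomial.C_0, RingHom.map_zero, Ideal.Quotient.eq_zero_iff_mem, mul_pow]
    exact Ideal.mul_mem_left _ _ (Ideal.subset_span ⟨i, rfl⟩)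

/-- Every unit of `R_k` squares to `1`. -/
lemma Rk.unit_sq_eq_one {k : ℕ} (u : (Rk k)ˣ) : (u : Rk k) ^ 2 = 1 := by
  obtain ⟨p, hp⟩ := Ideal.Quotient.mk_surjective (u : Rk k)
  obtain ⟨c, hc⟩ := Rk.exists_mk_sq_eq_mk_C k p
  rw [RingHom.map_pow, hp] at hc
  obtain rfl | rfl : c = 0 ∨ c = 1 := by clear hc; revert c; decide
  · rw [MvPolynomial.C_0, RingHom.map_zero] at hc
    have h : IsUnit ((u : Rk k) ^ 2) := u.isUnit.pow 2
    rw [hc] at h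
    have := subsingleton_of_zero_eq_one (isUnit_zero_iff.mp h)
    exact Subsingleton.elim _ _
  · rw [hc, MvPolynomial.C_1, RingHom.map_one]

section

variable {R : Type*} [CommRing R] {n : ℕ}

/-- The monomial map `ν` intertwines `T_λ` with `λ T` when `λ ^ (n - 1) = 1`. -/
lemma monomial_lamShift [NeZero n] {lam : R} (h : lam ^ (n - 1) = 1) (a : Fin n → R) :
    (fun i : Fin n => lam ^ (i : ℕ) * lamShift lam a i) =
      lamShift 1 (fun i : Fin n => lam ^ (i : ℕ) * (lam • a) i) := by
  obtain ⟨m, rfl⟩ := Nat.exists_eq_succ_of_ne_zero (NeZero.ne n)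
  funext i
  rw [Nat.succ_sub_one] at h
  cases i using Fin.cases with
  | zero =>
    simp [lamShift, h]
  | succ j =>
    have hj : j.succ - 1 = j.castSucc := by
      rw [sub_eq_iff_eq_add, Fin.coeSucc_eq_succ]
    simp only [lamShift, Fin.succ_ne_zero, if_false, hj, Fin.val_succ, Fin.val_castSucc,
      Pi.smul_apply, smul_eq_mul]
    ring

/-- Scaling by a unit fixes every submodule. -/
lemma Submodule.image_unit_smul_coe {M : Type*} [AddCommGroup M] [Module R M] (u : Rˣ)
    (N : Submodule R M) : (fun x : M => (u : R) • x) '' (N : Set M) = N := by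
  ext x
  constructor
  · rintro ⟨y, hy, rfl⟩
    exact N.smul_mem _ hy
  · intro hx
    exact ⟨(↑u⁻¹ : R) • x, N.smul_mem _ hx, by simp [smul_smul]⟩

/-- The monomial map attached to a unit is injective. -/
lemma monomial_injective (u : Rˣ) :
    Function.Injective (fun (a : Fin n → R) (i : Fin n) => (u : R) ^ (i : ℕ) * a i) := by
  intro a b hab
  funext i
  exact (u.isUnit.pow (i : ℕ)).mul_left_cancel (congrFun hab i)

/-- If `λ ^ (n - 1) = 1`, then `C` is `λ`-constacyclic if and only if `ν(C)` is cyclic. -/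
lemma constacyclic_iff_cyclic_of_pow_eq_one [NeZero n] (u : Rˣ) (h : (u : R) ^ (n - 1) = 1)
    (C : Submodule R (Fin n → R)) :
    lamShift (u : R) '' (C : Set (Fin n → R)) = (C : Set (Fin n → R)) ↔
    lamShift (1 : R) '' ((fun (a : Fin n → R) (i : Fin n) => (u : R) ^ (i : ℕ) * a i) ''
        (C : Set (Fin n → R))) =
      (fun (a : Fin n → R) (i : Fin n) => (u : R) ^ (i : ℕ) * a i) ''
        (C : Set (Fin n → R)) := by
  rw [← (monomial_injective u).image_injective.eq_iff, Set.image_image]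
  simp_rw [monomial_lamShift h]
  rw [← Set.image_image (lamShift 1), ← Set.image_image
    (fun (a : Fin n → R) (i : Fin n) => (u : R) ^ (i : ℕ) * a i) (fun a => (u : R) • a),
    Submodule.image_unit_smul_coe]

end

set_option synthInstance.maxHeartbeats 1000000 in
theorem constacyclic_iff_cyclic_of_odd_length (k : ℕ) (hk : 1 ≤ k)
    (lam : (Rk k)ˣ) (n : ℕ) [NeZero n] (hn : Odd n)
    (C : Submodule (Rk k) (Fin n → Rk k)) :
    lamShift (lam : Rk k) '' (C : Set (Fin n → Rk k)) = (C : Set (Fin n → Rk k)) ↔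
    lamShift (1 : Rk k) ''
        ((fun (a : Fin n → Rk k) (i : Fin n) => (lam : Rk k) ^ (i : ℕ) * a i) ''
          (C : Set (Fin n → Rk k))) =
      (fun (a : Fin n → Rk k) (i : Fin n) => (lam : Rk k) ^ (i : ℕ) * a i) ''
        (C : Set (Fin n → Rk k)) := by
  refine constacyclic_iff_cyclic_of_pow_eq_one lam ?_ C
  obtain ⟨m, rfl⟩ := hn
  rw [Nat.add_sub_cancel, pow_mul, Rk.unit_sq_eq_one, one_pow]
end

section
/- Let k ≥ 1, n ≥ 1, and let C be the repetition code of length n over R_k, i.e. the R_k-submodule of R_k^n generated by the all-ones vector (1, 1, …, 1). Then C has exactly 2^(2^k) elements, every nonzero codeword of C has homogeneous weight at least n·2^(2^k−2), and some nonzero codeword of C has homogeneous weight exactly n·2^(2^k−2); that is, the minimum homogeneous weight of C equals n·2^(2^k−2). (Hence its homogeneous Gray image is a binary [n·2^(2^k−1), 2^k, n·2^(2^k−2)] code.) -/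
open MvPolynomial

/-- The square-free exponent vector in `Fin k →₀ ℕ` with the given zero-one entries. -/
noncomputable def squarefreeExponent (k : ℕ) (g : Fin k → Fin 2) : Fin k →₀ ℕ :=
  Finsupp.equivFunOnFinite.symm fun i => (g i : ℕ)

theorem squarefreeExponent_injective (k : ℕ) : Function.Injective (squarefreeExponent k) := by
  intro g h hgh
  funext i
  exact Fin.ext (DFunLike.congr_fun hgh i)

/-- The coefficients of a polynomial at the square-free monomials. -/
noncomputable def squarefreeCoeffs (k : ℕ) :
    MvPolynomial (Fin k) (ZMod 2) →ₗ[ZMod 2] ((Fin k → Fin 2) → ZMod 2) :=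
  LinearMap.pi fun g => lcoeff (ZMod 2) (squarefreeExponent k g)

theorem squarefreeCoeffs_apply (k : ℕ) (f : MvPolynomial (Fin k) (ZMod 2)) (g : Fin k → Fin 2) :
    squarefreeCoeffs k f g = coeff (squarefreeExponent k g) f := rfl

theorem squarefreeCoeffs_surjective (k : ℕ) : Function.Surjective (squarefreeCoeffs k) := by
  intro h
  refine ⟨∑ g, monomial (squarefreeExponent k g) (h g), ?_⟩
  funext g
  simp [squarefreeCoeffs_apply, coeff_sum, coeff_monomial, (squarefreeExponent_injective k).eq_iff]

theorem mem_span_sq_iff (k : ℕ) (f : MvPolynomial (Fin k) (ZMod 2)) :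
    f ∈ Ideal.span (Set.range fun i : Fin k => (X i : MvPolynomial (Fin k) (ZMod 2)) ^ 2) ↔
      ∀ m ∈ f.support, ∃ i, 2 ≤ m i := by
  have hset : (Set.range fun i : Fin k => (X i : MvPolynomial (Fin k) (ZMod 2)) ^ 2) =
      (fun s => monomial s (1 : ZMod 2)) '' Set.range fun i : Fin k => Finsupp.single i 2 := by
    rw [← Set.range_comp]
    simp only [X_pow_eq_monomial, Function.comp_def]
  rw [hset, mem_ideal_span_monomial_image]
  simp [Finsupp.single_le_iff]

theorem ker_squarefreeCoeffs (k : ℕ) :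
    LinearMap.ker (squarefreeCoeffs k) =
      (Ideal.span (Set.range fun i : Fin k =>
        (X i : MvPolynomial (Fin k) (ZMod 2)) ^ 2)).restrictScalars (ZMod 2) := by
  ext f
  rw [Submodule.restrictScalars_mem, mem_span_sq_iff, LinearMap.mem_ker]
  constructor
  · intro h m hm
    by_contra! hlt
    have hm_eq : squarefreeExponent k (fun i => ⟨m i, hlt i⟩) = m := by
      ext i
      rfl
    refine mem_support_iff.1 hm ?_
    rw [← hm_eq, ← squarefreeCoeffs_apply, h, Pi.zero_apply]
  · intro h
    funext g
    by_contra hne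
    obtain ⟨i, hi⟩ := h _ (mem_support_iff.2 hne)
    exact absurd hi (not_le.2 (g i).isLt)

theorem card_Rk (k : ℕ) : Nat.card (Rk k) = 2 ^ 2 ^ k := by
  have e := (Submodule.Quotient.restrictScalarsEquiv (ZMod 2)
    (Ideal.span (Set.range fun i : Fin k =>
      (X i : MvPolynomial (Fin k) (ZMod 2)) ^ 2))).symm.toEquiv.trans
    ((Submodule.quotEquivOfEq _ _ (ker_squarefreeCoeffs k).symm).toEquiv.trans
      ((squarefreeCoeffs k).quotKerEquivOfSurjective (squarefreeCoeffs_surjective k)).toEquiv)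
  rw [Nat.card_congr e]
  simp

/-- The residue map `R_k → F_2` sending every `u_i` to zero. -/
noncomputable def Rk.residue (k : ℕ) : Rk k →+* ZMod 2 :=
  Ideal.Quotient.lift _ constantCoeff (by
    intro f hf
    have hle : Ideal.span (Set.range fun i : Fin k =>
        (X i : MvPolynomial (Fin k) (ZMod 2)) ^ 2) ≤ RingHom.ker constantCoeff := by
      rw [Ideal.span_le]
      rintro _ ⟨i, rfl⟩
      simp [RingHom.mem_ker]
    exact RingHom.mem_ker.1 (hle hf))

theorem Rk.one_ne_zero (k : ℕ) : (1 : Rk k) ≠ 0 := by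
  intro h
  simpa using congr_arg (Rk.residue k) h

theorem residue_uProd {k : ℕ} (hk : 1 ≤ k) : Rk.residue k (uProd k) = 0 := by
  rw [uProd, Rk.residue, Ideal.Quotient.lift_mk, map_prod]
  exact Finset.prod_eq_zero (Finset.mem_univ ⟨0, hk⟩) (constantCoeff_X _ _)

theorem one_ne_uProd {k : ℕ} (hk : 1 ≤ k) : (1 : Rk k) ≠ uProd k := by
  intro h
  simpa [residue_uProd hk] using congr_arg (Rk.residue k) h

theorem whom_one {k : ℕ} (hk : 1 ≤ k) : whom k 1 = 2 ^ (2 ^ k - 2) := by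
  rw [whom, if_neg (Rk.one_ne_zero k), if_neg (one_ne_uProd hk)]

theorem le_whom {k : ℕ} {x : Rk k} (hx : x ≠ 0) : 2 ^ (2 ^ k - 2) ≤ whom k x := by
  rw [whom, if_neg hx]
  split_ifs
  · exact Nat.pow_le_pow_right two_pos (by omega)
  · exact le_rfl

theorem mem_span_const_one_iff {R ι : Type*} [CommRing R] (c : ι → R) :
    c ∈ Submodule.span R {fun _ : ι => (1 : R)} ↔ ∃ a : R, c = fun _ => a := by
  rw [Submodule.mem_span_singleton]
  refine exists_congr fun a => ?_
  rw [eq_comm]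
  simp [Pi.smul_def]

theorem card_span_const_one {R ι : Type*} [CommRing R] [Nonempty ι] :
    Nat.card (Submodule.span R {fun _ : ι => (1 : R)}) = Nat.card R := by
  refine (Nat.card_eq_of_bijective
    (fun a : R => (⟨fun _ => a, (mem_span_const_one_iff _).2 ⟨a, rfl⟩⟩ :
      Submodule.span R {fun _ : ι => (1 : R)})) ⟨?_, ?_⟩).symm
  · intro a b hab
    exact congr_fun (Subtype.ext_iff.1 hab) (Classical.arbitrary ι)
  · rintro ⟨c, hc⟩
    obtain ⟨a, rfl⟩ := (mem_span_const_one_iff c).1 hc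
    exact ⟨a, rfl⟩

set_option synthInstance.maxHeartbeats 1000000 in
theorem repetition_code_parameters (k n : ℕ) (hk : 1 ≤ k) (hn : 1 ≤ n) :
    Nat.card (Submodule.span (Rk k) {fun _ : Fin n => (1 : Rk k)}) = 2 ^ (2 ^ k) ∧
    (∀ c ∈ Submodule.span (Rk k) {fun _ : Fin n => (1 : Rk k)}, c ≠ 0 →
      n * 2 ^ (2 ^ k - 2) ≤ ∑ i, whom k (c i)) ∧
    (∃ c ∈ Submodule.span (Rk k) {fun _ : Fin n => (1 : Rk k)}, c ≠ 0 ∧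
      ∑ i, whom k (c i) = n * 2 ^ (2 ^ k - 2)) := by
  have : Nonempty (Fin n) := ⟨⟨0, hn⟩⟩
  refine ⟨card_span_const_one.trans (card_Rk k), ?_, ?_⟩
  · intro c hc hne
    obtain ⟨a, rfl⟩ := (mem_span_const_one_iff c).1 hc
    have ha : a ≠ 0 := by
      rintro rfl
      exact hne rfl
    simpa using Nat.mul_le_mul_left n (le_whom ha)
  · refine ⟨fun _ => 1, (mem_span_const_one_iff _).2 ⟨1, rfl⟩, ?_, ?_⟩
    · intro h
      exact Rk.one_ne_zero k (congr_fun h ⟨0, hn⟩)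
    · simp [whom_one hk]
end

section
/- Let R_1 = F_2[u]/(u²) and let w_hom be the homogeneous weight on R_1, namely w_hom(0) = 0, w_hom(u) = 2, w_hom(1) = w_hom(1+u) = 1, extended to vectors coordinatewise. Then for every m ≥ 1 there exists an R_1-submodule C of R_1^(3m) containing exactly 4 elements such that every nonzero codeword of C has homogeneous weight exactly 4m. (Hence its Gray image is a binary [6m, 2, 4m] code, which attains the Griesmer bound.) -/
open Polynomial

/-- The ring `R_1 = F_2[u]/(u²) = F_2 + uF_2`. -/
abbrev R1 : Type :=
  Polynomial (ZMod 2) ⧸ Ideal.span {(X : Polynomial (ZMod 2)) ^ 2}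

/-- The element `u ∈ R_1`. -/
noncomputable def uR1 : R1 :=
  Ideal.Quotient.mk _ (X : Polynomial (ZMod 2))

open Classical in
/-- The homogeneous weight on `R_1`: `w(0) = 0`, `w(u) = 2`, `w(1) = w(1+u) = 1`. -/
noncomputable def whomR1 (x : R1) : ℕ :=
  if x = 0 then 0 else if x = uR1 then 2 else 1

theorem R1.mk_eq_mk_iff (p q : Polynomial (ZMod 2)) :
    (Ideal.Quotient.mk _ p : R1) = Ideal.Quotient.mk _ q ↔
      p.coeff 0 = q.coeff 0 ∧ p.coeff 1 = q.coeff 1 := by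
  rw [Ideal.Quotient.eq, Ideal.mem_span_singleton, X_pow_dvd_iff]
  constructor
  · intro h
    exact ⟨by simpa [sub_eq_zero] using h 0 (by norm_num),
      by simpa [sub_eq_zero] using h 1 (by norm_num)⟩
  · rintro ⟨h0, h1⟩ d hd
    interval_cases d <;> simp [*]

theorem R1.bijective_mk_linear :
    Function.Bijective fun a : ZMod 2 × ZMod 2 =>
      (Ideal.Quotient.mk _ (C a.1 + C a.2 * X) : R1) := by
  constructor
  · intro a b h
    have := (R1.mk_eq_mk_iff _ _).1 h
    exact Prod.ext (by simpa using this.1) (by simpa [coeff_C] using this.2)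
  · intro x
    obtain ⟨p, rfl⟩ := Ideal.Quotient.mk_surjective x
    exact ⟨(p.coeff 0, p.coeff 1), (R1.mk_eq_mk_iff _ _).2 (by simp [coeff_C])⟩

theorem R1.card_eq_four : Nat.card R1 = 4 := by
  rw [← Nat.card_congr (Equiv.ofBijective _ R1.bijective_mk_linear)]
  simp

/-- Every nonzero multiple of the word `(1, 1, u)` has homogeneous weight `4`. -/
theorem whomR1_add_whomR1_add_whomR1_mul_uR1 {x : R1} (hx : x ≠ 0) :
    whomR1 x + whomR1 x + whomR1 (x * uR1) = 4 := by
  obtain ⟨⟨a, b⟩, rfl⟩ := R1.bijective_mk_linear.2 x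
  have mk_zero_iff (p : Polynomial (ZMod 2)) :
      (Ideal.Quotient.mk _ p : R1) = 0 ↔ p.coeff 0 = 0 ∧ p.coeff 1 = 0 := by
    simpa using R1.mk_eq_mk_iff p 0
  simp only [ne_eq, mk_zero_iff] at hx
  simp only [whomR1, uR1, ← map_mul, mk_zero_iff, R1.mk_eq_mk_iff]
  have coeff_zero : (C a + C b * X).coeff 0 = a := by simp
  have coeff_one : (C a + C b * X).coeff 1 = b := by simp [coeff_C]
  simp only [coeff_zero, coeff_one, coeff_mul_X_zero, coeff_mul_X _ 0, coeff_X_zero,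
    coeff_X_one, true_and] at hx ⊢
  have eq_zero_or_eq_one : ∀ c : ZMod 2, c = 0 ∨ c = 1 := by decide
  clear coeff_zero coeff_one mk_zero_iff
  rcases eq_zero_or_eq_one a with rfl | rfl <;> rcases eq_zero_or_eq_one b with rfl | rfl <;>
    simp at hx ⊢

set_option synthInstance.maxHeartbeats 1000000 in
theorem exists_QT_code_with_image_6m_2_4m (m : ℕ) (hm : 1 ≤ m) :
    ∃ C : Submodule R1 (Fin (3 * m) → R1),
      Nat.card C = 4 ∧
      ∀ c ∈ C, c ≠ 0 → ∑ i, whomR1 (c i) = 4 * m := by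
  let v : Fin (3 * m) → R1 := fun i => ![1, 1, uR1] (finProdFinEquiv.symm i).1
  have hinj : Function.Injective (LinearMap.toSpanSingleton R1 (Fin (3 * m) → R1) v) := by
    intro x y hxy
    have := congrFun hxy (finProdFinEquiv (0, ⟨0, hm⟩))
    simpa only [LinearMap.toSpanSingleton_apply, Pi.smul_apply, smul_eq_mul, v,
      Equiv.symm_apply_apply, Matrix.cons_val, mul_one] using this
  refine ⟨LinearMap.range (LinearMap.toSpanSingleton R1 _ v), ?_, ?_⟩
  · rw [← Nat.card_congr (LinearEquiv.ofInjective _ hinj).toEquiv, R1.card_eq_four]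
  · rintro _ ⟨x, rfl⟩ hc
    have hx : x ≠ 0 := by
      rintro rfl
      exact hc (map_zero _)
    rw [← finProdFinEquiv.sum_comp, Fintype.sum_prod_type]
    simp only [LinearMap.toSpanSingleton_apply, Pi.smul_apply, smul_eq_mul, v,
      Equiv.symm_apply_apply, Finset.sum_const, Finset.card_univ, Fintype.card_fin,
      Fin.sum_univ_three, Matrix.cons_val, mul_one]
    rw [← mul_add, ← mul_add, whomR1_add_whomR1_add_whomR1_mul_uR1 hx, mul_comm]
end
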